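/- arXiv:2511.21148 — 2 statements merged into one kernel-verified Lean document; each statement's English description precedes it below -/
import Mathlib

section
/- Let α = (α_1, …, α_d) ∈ ℝ^d be such that 1, α_1, …, α_d are linearly independent over the rationals, and let A, B ⊆ ℝ^d be two bounded remainder sets with respect to α having the same Lebesgue measure. Then A and B are equidecomposable up to measure zero with Lebesgue measurable pieces, using only translations by vectors in ℤα + ℤ^d. -/
open Pointwise MeasureTheory

/-- `P` is a partition of `A` into finitely many (possibly empty) pieces. -/
def IsPartitionOf {X : Type*} {n : ℕ} (P : Fin n → Set X) (A : Set X) : Prop :=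
  (⋃ i, P i) = A ∧ Pairwise (Function.onFun Disjoint P)

/-- The multiplicity function `χ_A(x) = Σ_{k ∈ ℤ^d} 1_A(x + k)` of the projection of `A`
onto the torus `ℝ^d/ℤ^d`. -/
noncomputable def chiFun {d : ℕ} (A : Set (Fin d → ℝ)) (x : Fin d → ℝ) : ℝ :=
  ∑' k : Fin d → ℤ, Set.indicator A 1 (x + fun i => (k i : ℝ))

/-- `A` is a bounded remainder set with respect to `α`:
`|Σ_{k=0}^{n-1} χ_A(x + kα) − n · mes A| ≤ C` for all `n ≥ 1` and a.e. `x`. -/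
def IsBRS {d : ℕ} (α : Fin d → ℝ) (A : Set (Fin d → ℝ)) : Prop :=
  ∃ C : ℝ, ∀ n : ℕ, 1 ≤ n → ∀ᵐ x ∂(volume : Measure (Fin d → ℝ)),
    |∑ k ∈ Finset.range n, chiFun A (x + (k : ℝ) • α) - (n : ℝ) * (volume A).toReal| ≤ C

/-- `A` and `B` are equidecomposable up to measure zero with Lebesgue measurable pieces,
using only translations by vectors in the set `H`. -/
def EquidecompUpToNullMeasPieces {d : ℕ} (A B : Set (Fin d → ℝ)) (H : Set (Fin d → ℝ)) :
    Prop :=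
  ∃ (k : ℕ) (P : Fin k → Set (Fin d → ℝ)) (h : Fin k → (Fin d → ℝ)) (X' : Set (Fin d → ℝ)),
    volume X'ᶜ = 0 ∧
    (∀ j, MeasurableSet (P j)) ∧ (∀ j, h j ∈ H) ∧
    IsPartitionOf (fun j => P j ∩ X') (A ∩ X') ∧
    IsPartitionOf (fun j => (h j +ᵥ P j) ∩ X') (B ∩ X')


open Filter

def zc {d : ℕ} (k : Fin d → ℤ) : Fin d → ℝ := fun i => (k i : ℝ)

lemma zc_add {d : ℕ} (k l : Fin d → ℤ) : zc (k + l) = zc k + zc l := by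
  ext i; simp [zc]

lemma zc_neg {d : ℕ} (k : Fin d → ℤ) : zc (-k) = -zc k := by
  ext i; simp [zc]

lemma zc_finite {d : ℕ} (R : ℝ) : {k : Fin d → ℤ | ‖zc k‖ ≤ R}.Finite := by
  refine (Set.finite_Icc (fun _ : Fin d => -⌈R⌉) (fun _ => ⌈R⌉)).subset ?_
  intro k hk
  have h : ∀ i, |(k i : ℝ)| ≤ ⌈R⌉ := fun i =>
    ((norm_le_pi_norm (zc k) i).trans hk).trans (Int.le_ceil R)
  constructor
  · intro i
    have := (abs_le.1 (h i)).1
    exact_mod_cast this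
  · intro i
    have := (abs_le.1 (h i)).2
    exact_mod_cast this

lemma fib_finite {d : ℕ} {A : Set (Fin d → ℝ)} (hA : Bornology.IsBounded A) (x : Fin d → ℝ) :
    {k : Fin d → ℤ | x + zc k ∈ A}.Finite := by
  obtain ⟨R, hR⟩ := hA.exists_norm_le
  refine (zc_finite (R + ‖x‖)).subset ?_
  intro k hk
  have h1 := hR _ hk
  have : zc k = (x + zc k) - x := by abel
  show ‖zc k‖ ≤ _
  rw [this]
  exact (norm_sub_le _ _).trans (by linarith)

/-- Number of points of `A` in the fiber of `x`. -/
noncomputable def cnt {d : ℕ} (A : Set (Fin d → ℝ)) (x : Fin d → ℝ) : ℤ :=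
  ({k : Fin d → ℤ | x + zc k ∈ A}.ncard : ℤ)

/-- Rank of `x` in its fiber. -/
noncomputable def rk {d : ℕ} (A : Set (Fin d → ℝ)) (x : Fin d → ℝ) : ℤ :=
  ({k : Fin d → ℤ | toLex k < 0 ∧ x + zc k ∈ A}.ncard : ℤ)

lemma measurable_ncard_fib {X K : Type*} [MeasurableSpace X] [Countable K] (p : K → Set X)
    (hp : ∀ k, MeasurableSet (p k)) (hf : ∀ x, {k | x ∈ p k}.Finite) :
    Measurable (fun x => {k | x ∈ p k}.ncard) := by
  refine measurable_of_Ici fun i => ?_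
  have : (fun x => {k | x ∈ p k}.ncard) ⁻¹' Set.Ici i =
      ⋃ F : {F : Finset K // F.card = i}, ⋂ k ∈ F.1, p k := by
    ext x
    simp only [Set.mem_preimage, Set.mem_Ici, Set.mem_iUnion, Set.mem_iInter]
    constructor
    · intro h
      rw [Set.ncard_eq_toFinset_card _ (hf x)] at h
      obtain ⟨t, ht, htc⟩ := Finset.exists_subset_card_eq h
      exact ⟨⟨t, htc⟩, fun k hk => by simpa using ht hk⟩
    · rintro ⟨⟨F, hF⟩, h⟩
      rw [← hF, ← Set.ncard_coe_finset]
      exact Set.ncard_le_ncard (fun k hk => h k (by simpa using hk)) (hf x)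
  rw [this]
  exact MeasurableSet.iUnion fun F => Finset.measurableSet_biInter _ fun k _ => hp k

lemma measurable_cnt {d : ℕ} {A : Set (Fin d → ℝ)} (hA : Bornology.IsBounded A)
    (hAm : MeasurableSet A) : Measurable (cnt A) := by
  have := measurable_ncard_fib (fun k : Fin d → ℤ => {x | x + zc k ∈ A})
    (fun k => (measurable_id.add_const _) hAm) (fun x => fib_finite hA x)
  exact (measurable_from_nat (f := fun n : ℕ => (n : ℤ))).comp this

lemma measurable_rk {d : ℕ} {A : Set (Fin d → ℝ)} (hA : Bornology.IsBounded A)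
    (hAm : MeasurableSet A) : Measurable (rk A) := by
  have := measurable_ncard_fib (fun k : Fin d → ℤ => {x | toLex k < 0 ∧ x + zc k ∈ A})
    (fun k => (MeasurableSet.const _).inter ((measurable_id.add_const _) hAm))
    (fun x => (fib_finite hA x).subset fun k hk => hk.2)
  exact (measurable_from_nat (f := fun n : ℕ => (n : ℤ))).comp this

lemma cnt_add {d : ℕ} (A : Set (Fin d → ℝ)) (x : Fin d → ℝ) (l : Fin d → ℤ) :
    cnt A (x + zc l) = cnt A x := by
  unfold cnt
  congr 1
  refine Set.ncard_congr (fun k _ => l + k) ?_ ?_ ?_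
  · intro k hk
    simpa [zc_add, add_assoc] using hk
  · intro a b _ _ h
    simpa using h
  · intro k hk
    refine ⟨k - l, ?_, by abel⟩
    simpa [sub_eq_add_neg, zc_add, zc_neg, add_assoc] using hk

lemma rk_add {d : ℕ} (A : Set (Fin d → ℝ)) (x : Fin d → ℝ) (l : Fin d → ℤ) :
    rk A (x + zc l) = ({k : Fin d → ℤ | toLex k < toLex l ∧ x + zc k ∈ A}.ncard : ℤ) := by
  unfold rk
  congr 1
  refine Set.ncard_congr (fun k _ => l + k) ?_ ?_ ?_
  · intro k hk
    refine ⟨?_, by simpa [zc_add, add_assoc] using hk.2⟩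
    rw [toLex_add]
    have := add_lt_add_right hk.1 (toLex l)
    simpa using this
  · intro a b _ _ h
    simpa using h
  · intro k hk
    refine ⟨k - l, ⟨?_, ?_⟩, by abel⟩
    · rw [toLex_sub]
      exact sub_neg.2 hk.1
    · simpa [sub_eq_add_neg, zc_add, zc_neg, add_assoc] using hk.2

lemma rank_bij {K : Type*} [LinearOrder K] (S : Set K) (hS : S.Finite) (i : ℕ) (hi : i < S.ncard) :
    ∃ k ∈ S, {k' | k' < k ∧ k' ∈ S}.ncard = i := by
  have h := Finset.surjOn_of_injOn_of_card_le (s := hS.toFinset) (t := Finset.range S.ncard)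
    (fun k => {k' | k' < k ∧ k' ∈ S}.ncard) ?_ ?_ ?_
  · obtain ⟨k, hk, h2⟩ := h (show i ∈ _ by simpa using hi)
    exact ⟨k, by simpa using hk, h2⟩
  · intro k hk
    simp only [Finset.coe_range, Set.mem_Iio]
    refine Set.ncard_lt_ncard ⟨fun x hx => hx.2, fun h => ?_⟩ hS
    exact lt_irrefl _ (h (show k ∈ S by simpa using hk)).1
  · have key : ∀ a ∈ S, ∀ b, a < b →
        {k' | k' < a ∧ k' ∈ S}.ncard < {k' | k' < b ∧ k' ∈ S}.ncard := by
      intro a ha b hab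
      refine Set.ncard_lt_ncard ⟨fun x hx => ⟨hx.1.trans hab, hx.2⟩, fun h => ?_⟩
        (hS.subset fun x hx => hx.2)
      exact lt_irrefl _ (h ⟨hab, ha⟩).1
    intro a ha b hb hab
    simp only [Set.Finite.coe_toFinset] at ha hb
    rcases lt_trichotomy a b with h | h | h
    · exact absurd hab (key a ha b h).ne
    · exact h
    · exact absurd hab (key b hb a h).ne'
  · rw [Finset.card_range, Set.ncard_eq_toFinset_card _ hS]

lemma rk_lt {d : ℕ} {A : Set (Fin d → ℝ)} (hA : Bornology.IsBounded A) {x : Fin d → ℝ}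
    (hx : x ∈ A) : rk A x < cnt A x := by
  unfold rk cnt
  norm_cast
  refine Set.ncard_lt_ncard ⟨fun k hk => hk.2, fun h => ?_⟩ (fib_finite hA x)
  have : (0 : Fin d → ℤ) ∈ {k : Fin d → ℤ | x + zc k ∈ A} := by
    have : zc (0 : Fin d → ℤ) = 0 := by ext i; simp [zc]
    simpa [this] using hx
  exact lt_irrefl _ (h this).1

lemma rk_nonneg {d : ℕ} (A : Set (Fin d → ℝ)) (x : Fin d → ℝ) : 0 ≤ rk A x := by
  unfold rk; positivity

lemma cnt_nonneg {d : ℕ} (A : Set (Fin d → ℝ)) (x : Fin d → ℝ) : 0 ≤ cnt A x := by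
  unfold cnt; positivity

lemma rk_exists {d : ℕ} {A : Set (Fin d → ℝ)} (hA : Bornology.IsBounded A) (x : Fin d → ℝ)
    (i : ℤ) (hi : 0 ≤ i) (hi2 : i < cnt A x) : ∃ k, x + zc k ∈ A ∧ rk A (x + zc k) = i := by
  lift i to ℕ using hi
  unfold cnt at hi2
  have hS : {k : Lex (Fin d → ℤ) | x + zc (ofLex k) ∈ A}.Finite := fib_finite hA x
  obtain ⟨k, hk, h⟩ := rank_bij {k : Lex (Fin d → ℤ) | x + zc (ofLex k) ∈ A} hS i
    (by exact_mod_cast hi2)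
  refine ⟨ofLex k, hk, ?_⟩
  rw [rk_add]
  exact_mod_cast h

lemma rk_unique {d : ℕ} {A : Set (Fin d → ℝ)} (hA : Bornology.IsBounded A) (x : Fin d → ℝ)
    (k l : Fin d → ℤ) (hk : x + zc k ∈ A) (hl : x + zc l ∈ A)
    (h : rk A (x + zc k) = rk A (x + zc l)) : k = l := by
  have key : ∀ a b : Fin d → ℤ, x + zc a ∈ A → toLex a < toLex b →
      rk A (x + zc a) < rk A (x + zc b) := by
    intro a b ha hab
    rw [rk_add, rk_add]
    norm_cast
    refine Set.ncard_lt_ncard ⟨fun x hx => ⟨hx.1.trans hab, hx.2⟩, fun h => ?_⟩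
        ((fib_finite hA x).subset fun x hx => hx.2)
    exact lt_irrefl _ (h ⟨hab, ha⟩).1
  rcases lt_trichotomy (toLex k) (toLex l) with h' | h' | h'
  · exact absurd h (key _ _ hk h').ne
  · exact toLex.injective h'
  · exact absurd h (key _ _ hl h').ne'

lemma chiFun_eq {d : ℕ} {A : Set (Fin d → ℝ)} (hA : Bornology.IsBounded A) (x : Fin d → ℝ) :
    chiFun A x = (cnt A x : ℝ) := by
  unfold chiFun cnt
  have hf := fib_finite hA x
  rw [tsum_eq_sum (s := hf.toFinset)]
  · rw [Set.ncard_eq_toFinset_card _ hf, Finset.sum_congr rfl (g := fun _ => (1 : ℝ))]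
    · simp
    · intro k hk
      have : x + zc k ∈ A := by simpa using hk
      exact Set.indicator_of_mem (f := 1) this
  · intro k hk
    have : x + zc k ∉ A := by simpa using hk
    exact Set.indicator_of_notMem (f := 1) this

lemma crossing (u : ℕ → ℤ) (j : ℤ) (N : ℕ) (h0 : u 0 ≤ j) (hN : j < u N) :
    ∃ n, n < N ∧ u n ≤ j ∧ j < u (n + 1) := by
  classical
  have hex : ∃ n, j < u n := ⟨N, hN⟩
  have h1 := Nat.find_spec hex
  have h2 := Nat.find_min' hex hN
  have hne : Nat.find hex ≠ 0 := by
    intro h; rw [h] at h1; omega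
  obtain ⟨m, hm⟩ := Nat.exists_eq_succ_of_ne_zero hne
  refine ⟨m, by omega, ?_, ?_⟩
  · exact not_lt.1 (Nat.find_min hex (m := m) (by omega))
  · rwa [hm] at h1

lemma crossing_unique (u : ℕ → ℤ) (hu : Monotone u) (j : ℤ) (n m : ℕ) (h1 : u n ≤ j)
    (h2 : j < u (n + 1)) (h3 : u m ≤ j) (h4 : j < u (m + 1)) : n = m := by
  by_contra hne
  rcases lt_or_gt_of_ne hne with h | h
  · have := hu (show n + 1 ≤ m from h); omega
  · have := hu (show m + 1 ≤ n from h); omega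


/-- Birkhoff sums of `cnt`. -/
noncomputable def bsum {d : ℕ} (α : Fin d → ℝ) (A : Set (Fin d → ℝ)) (n : ℕ) (x : Fin d → ℝ) : ℤ :=
  ∑ k ∈ Finset.range n, cnt A (x + (k : ℝ) • α)

lemma bsum_succ {d : ℕ} (α : Fin d → ℝ) (A : Set (Fin d → ℝ)) (n : ℕ) (x : Fin d → ℝ) :
    bsum α A (n + 1) x = bsum α A n x + cnt A (x + (n : ℝ) • α) := by
  simp [bsum, Finset.sum_range_succ]

lemma bsum_succ' {d : ℕ} (α : Fin d → ℝ) (A : Set (Fin d → ℝ)) (n : ℕ) (x : Fin d → ℝ) :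
    bsum α A (n + 1) x = cnt A x + bsum α A n (x + α) := by
  unfold bsum
  rw [Finset.sum_range_succ', add_comm]
  congr 1
  · simp
  · refine Finset.sum_congr rfl fun k _ => ?_
    congr 1
    push_cast
    rw [add_smul, one_smul]; abel

lemma bsum_zc {d : ℕ} (α : Fin d → ℝ) (A : Set (Fin d → ℝ)) (n : ℕ) (x : Fin d → ℝ)
    (l : Fin d → ℤ) : bsum α A n (x + zc l) = bsum α A n x := by
  unfold bsum
  refine Finset.sum_congr rfl fun k _ => ?_
  rw [add_right_comm, cnt_add]

lemma measurable_bsum {d : ℕ} (α : Fin d → ℝ) {A : Set (Fin d → ℝ)} (hA : Bornology.IsBounded A)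
    (hAm : MeasurableSet A) (n : ℕ) : Measurable (bsum α A n) := by
  unfold bsum
  exact Finset.measurable_fun_sum _ fun k _ =>
    (measurable_cnt hA hAm).comp (measurable_id.add_const _)

lemma exists_transfer {d : ℕ} (α : Fin d → ℝ) {A B X : Set (Fin d → ℝ)}
    (hA : Bornology.IsBounded A) (hAm : MeasurableSet A)
    (hB : Bornology.IsBounded B) (hBm : MeasurableSet B) (m C : ℝ)
    (hXα : ∀ x ∈ X, x + α ∈ X)
    (hAb : ∀ x ∈ X, ∀ n : ℕ, |(bsum α A n x : ℝ) - n * m| ≤ C)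
    (hBb : ∀ x ∈ X, ∀ n : ℕ, |(bsum α B n x : ℝ) - n * m| ≤ C) :
    ∃ φ : (Fin d → ℝ) → ℤ, ∃ M : ℤ, Measurable φ ∧ (∀ x k, φ (x + zc k) = φ x) ∧
      (∀ x ∈ X, cnt A x + φ (x + α) = cnt B x + φ x) ∧
      (∀ x ∈ X, φ x + cnt B x ≤ 0) ∧ (∀ x ∈ X, -M ≤ φ x) := by
  set h : ℕ → (Fin d → ℝ) → ℤ := fun n x => bsum α A n x - bsum α B n x with hh
  set M : ℤ := ⌈2 * C⌉ with hM
  set G : ℤ := ⌈m + C⌉ with hG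
  have hbd : ∀ x ∈ X, ∀ n, |h n x| ≤ M := by
    intro x hx n
    have h1 := abs_le.1 (hAb x hx n)
    have h2 := abs_le.1 (hBb x hx n)
    have h3 : |((h n x : ℤ) : ℝ)| ≤ M := by
      refine le_trans ?_ (Int.le_ceil (2 * C))
      simp only [hh, Int.cast_sub]
      rw [abs_le]; constructor <;> linarith
    exact_mod_cast h3
  have hcB : ∀ x ∈ X, cnt B x ≤ G := by
    intro x hx
    have h1 := abs_le.1 (hBb x hx 1)
    have h2 : bsum α B 1 x = cnt B x := by simp [bsum]
    rw [h2] at h1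
    have h3 : (cnt B x : ℝ) ≤ G := by
      refine le_trans ?_ (Int.le_ceil (m + C))
      push_cast at h1
      linarith
    exact_mod_cast h3
  have bdd : ∀ x ∈ X, IsBoundedUnder (· ≤ ·) atTop (fun n => h n x) := fun x hx =>
    isBoundedUnder_of ⟨M, fun n => (abs_le.1 (hbd x hx n)).2⟩
  have bddg : ∀ x ∈ X, IsBoundedUnder (· ≥ ·) atTop (fun n => h n x) := fun x hx =>
    isBoundedUnder_of ⟨-M, fun n => (abs_le.1 (hbd x hx n)).1⟩
  refine ⟨fun x => limsup (fun n => h n x) atTop - M - G, 2 * M + G, ?_, ?_, ?_, ?_, ?_⟩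
  · have : Measurable fun x => limsup (fun n => h n x) atTop :=
      Measurable.limsup fun n => (measurable_bsum α hA hAm n).sub (measurable_bsum α hB hBm n)
    exact (this.sub_const _).sub_const _
  · intro x k
    simp only [hh, bsum_zc]
  · intro x hx
    have e1 : limsup (fun n => h n x) atTop = limsup (fun n => h (n + 1) x) atTop :=
      (limsup_nat_add (fun n => h n x) 1).symm
    have e2 : (fun n => h (n + 1) x) = fun n => (cnt A x - cnt B x) + h n (x + α) := by
      ext n
      simp only [hh, bsum_succ']; ring
    have e3 := limsup_const_add atTop (fun n => h n (x + α)) (cnt A x - cnt B x)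
      (bdd _ (hXα x hx)) (bddg _ (hXα x hx)).isCoboundedUnder_le
    rw [e2, e3] at e1
    simp only
    rw [e1]; ring
  · intro x hx
    have : limsup (fun n => h n x) atTop ≤ M :=
      limsup_le_of_le (bddg x hx).isCoboundedUnder_le
        (Eventually.of_forall fun n => (abs_le.1 (hbd x hx n)).2)
    have := hcB x hx
    simp only
    linarith
  · intro x hx
    have : -M ≤ limsup (fun n => h n x) atTop :=
      le_limsup_of_frequently_le
        (Frequently.of_forall fun n => (abs_le.1 (hbd x hx n)).1) (bdd x hx)
    simp only
    linarith

/-- The matching relation: `a` is sent to `a + nα + k`. -/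
def piece {d : ℕ} (α : Fin d → ℝ) (A B : Set (Fin d → ℝ)) (φ : (Fin d → ℝ) → ℤ)
    (n : ℕ) (k : Fin d → ℤ) : Set (Fin d → ℝ) :=
  {a | a ∈ A ∧ a + (n : ℝ) • α + zc k ∈ B ∧
    rk A a = bsum α B n a + φ a + rk B (a + (n : ℝ) • α + zc k)}

lemma measurableSet_piece {d : ℕ} (α : Fin d → ℝ) {A B : Set (Fin d → ℝ)}
    (hA : Bornology.IsBounded A) (hAm : MeasurableSet A)
    (hB : Bornology.IsBounded B) (hBm : MeasurableSet B) {φ : (Fin d → ℝ) → ℤ}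
    (hφ : Measurable φ) (n : ℕ) (k : Fin d → ℤ) : MeasurableSet (piece α A B φ n k) := by
  have ht : Measurable fun a : Fin d → ℝ => a + (n : ℝ) • α + zc k :=
    (measurable_id.add_const _).add_const _
  refine hAm.inter ((ht hBm).inter ?_)
  exact measurableSet_eq_fun (measurable_rk hA hAm)
    (((measurable_bsum α hB hBm n).add hφ).add ((measurable_rk hB hBm).comp ht))

lemma bsum_mono {d : ℕ} (α : Fin d → ℝ) (A : Set (Fin d → ℝ)) (x : Fin d → ℝ) :
    Monotone fun n => bsum α A n x :=
  monotone_nat_of_le_succ fun n => by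
    rw [bsum_succ]; have := cnt_nonneg A (x + (n : ℝ) • α); linarith

lemma fwd_unique {d : ℕ} (α : Fin d → ℝ) {A B : Set (Fin d → ℝ)}
    (hB : Bornology.IsBounded B) {φ : (Fin d → ℝ) → ℤ} {a : Fin d → ℝ} {n n' : ℕ}
    {k k' : Fin d → ℤ} (h : a ∈ piece α A B φ n k) (h' : a ∈ piece α A B φ n' k') :
    n = n' ∧ k = k' := by
  have key : ∀ n k, a ∈ piece α A B φ n k → bsum α B n a + φ a ≤ rk A a ∧
      rk A a < bsum α B (n + 1) a + φ a := by
    rintro n k ⟨-, h2, h3⟩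
    have h4 := rk_nonneg B (a + (n : ℝ) • α + zc k)
    have h5 := rk_lt hB h2
    rw [cnt_add] at h5
    rw [bsum_succ]
    constructor <;> linarith
  have e : n = n' := by
    have k1 := key _ _ h
    have k2 := key _ _ h'
    exact crossing_unique (fun n => bsum α B n a + φ a)
      (fun i j hij => add_le_add_left (bsum_mono α B a hij) _) (rk A a) n n' k1.1 k1.2 k2.1 k2.2
  subst e
  refine ⟨rfl, rk_unique hB _ k k' h.2.1 h'.2.1 ?_⟩
  have := h.2.2
  have := h'.2.2
  linarith

lemma fwd_exists {d : ℕ} (α : Fin d → ℝ) {A B : Set (Fin d → ℝ)}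
    (hB : Bornology.IsBounded B) {φ : (Fin d → ℝ) → ℤ} {a : Fin d → ℝ} (ha : a ∈ A) (N : ℕ)
    (h0 : φ a ≤ 0) (hN : rk A a < bsum α B N a + φ a) :
    ∃ n k, n < N ∧ a ∈ piece α A B φ n k := by
  obtain ⟨n, hn, h1, h2⟩ := crossing (fun n => bsum α B n a + φ a) (rk A a) N
    (by have := rk_nonneg A a; simp only [bsum, Finset.range_zero, Finset.sum_empty]; linarith) hN
  simp only [bsum_succ] at h1 h2
  obtain ⟨k, hk, hk2⟩ := rk_exists hB (a + (n : ℝ) • α) (rk A a - (bsum α B n a + φ a))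
    (by linarith) (by linarith)
  exact ⟨n, k, hn, ha, hk, by rw [hk2]; ring⟩

/-- Backward sums. -/
lemma bsum_back {d : ℕ} (α : Fin d → ℝ) (A : Set (Fin d → ℝ)) (n : ℕ) (b : Fin d → ℝ) :
    bsum α A (n + 1) (b - ((n + 1 : ℕ) : ℝ) • α) =
      bsum α A n (b - (n : ℝ) • α) + cnt A (b - ((n + 1 : ℕ) : ℝ) • α) := by
  rw [bsum_succ', add_comm]
  congr 2
  push_cast
  rw [add_smul, one_smul]; abel

lemma transfer_iter {d : ℕ} (α : Fin d → ℝ) {A B X : Set (Fin d → ℝ)} {φ : (Fin d → ℝ) → ℤ}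
    (hXα : ∀ x ∈ X, ∀ n : ℤ, x + (n : ℝ) • α ∈ X)
    (hφ : ∀ x ∈ X, cnt A x + φ (x + α) = cnt B x + φ x) (n : ℕ) (x : Fin d → ℝ) (hx : x ∈ X) :
    bsum α A n x + φ (x + (n : ℝ) • α) = bsum α B n x + φ x := by
  induction n with
  | zero => simp [bsum]
  | succ n ih =>
    rw [bsum_succ, bsum_succ]
    have h := hφ (x + (n : ℝ) • α) (by simpa using hXα x hx n)
    have e : x + ((n + 1 : ℕ) : ℝ) • α = x + (n : ℝ) • α + α := by
      push_cast; rw [add_smul, one_smul]; abel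
    rw [e]; linarith

lemma piece_back {d : ℕ} (α : Fin d → ℝ) {A B X : Set (Fin d → ℝ)} {φ : (Fin d → ℝ) → ℤ}
    (hXα : ∀ x ∈ X, ∀ n : ℤ, x + (n : ℝ) • α ∈ X)
    (hφp : ∀ x k, φ (x + zc k) = φ x)
    (hφ : ∀ x ∈ X, cnt A x + φ (x + α) = cnt B x + φ x) (n : ℕ) (k : Fin d → ℤ)
    (b : Fin d → ℝ) (hb : b ∈ X) :
    b - (n : ℝ) • α + zc (-k) ∈ piece α A B φ n k ↔ b ∈ B ∧ b - (n : ℝ) • α + zc (-k) ∈ A ∧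
      rk A (b - (n : ℝ) • α + zc (-k)) = bsum α A n (b - (n : ℝ) • α) + φ b + rk B b := by
  have e : b - (n : ℝ) • α + zc (-k) + (n : ℝ) • α + zc k = b := by rw [zc_neg]; abel
  have hx : b - (n : ℝ) • α ∈ X := by
    have := hXα b hb (-n)
    simpa [sub_eq_add_neg] using this
  have t := transfer_iter α hXα hφ n _ hx
  rw [sub_add_cancel] at t
  unfold piece
  simp only [Set.mem_ofPred_eq, e, bsum_zc, hφp]
  rw [t]
  tauto

lemma bwd_unique {d : ℕ} (α : Fin d → ℝ) {A B X : Set (Fin d → ℝ)} {φ : (Fin d → ℝ) → ℤ}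
    (hA : Bornology.IsBounded A) (hB : Bornology.IsBounded B)
    (hXα : ∀ x ∈ X, ∀ n : ℤ, x + (n : ℝ) • α ∈ X)
    (hφp : ∀ x k, φ (x + zc k) = φ x)
    (hφ : ∀ x ∈ X, cnt A x + φ (x + α) = cnt B x + φ x)
    (hφ0 : ∀ x ∈ X, φ x + cnt B x ≤ 0) {n n' : ℕ} {k k' : Fin d → ℤ}
    {b : Fin d → ℝ} (hb : b ∈ X)
    (h : b - (n : ℝ) • α + zc (-k) ∈ piece α A B φ n k)
    (h' : b - (n' : ℝ) • α + zc (-k') ∈ piece α A B φ n' k') : n = n' ∧ k = k' := by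
  rw [piece_back α hXα hφp hφ _ _ _ hb] at h h'
  have key : ∀ (n : ℕ) (k : Fin d → ℤ), (b ∈ B ∧ b - (n : ℝ) • α + zc (-k) ∈ A ∧
      rk A (b - (n : ℝ) • α + zc (-k)) = bsum α A n (b - (n : ℝ) • α) + φ b + rk B b) →
      ∃ p, n = p + 1 ∧ bsum α A p (b - (p : ℝ) • α) + φ b + rk B b ≤ -1 ∧
        -1 < bsum α A (p + 1) (b - ((p + 1 : ℕ) : ℝ) • α) + φ b + rk B b := by
    rintro n k ⟨h1, h2, h3⟩
    have h4 := rk_nonneg A (b - (n : ℝ) • α + zc (-k))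
    have h5 := rk_lt hA h2
    rw [cnt_add] at h5
    have h6 := hφ0 b hb
    have h7 := rk_lt hB h1
    cases n with
    | zero =>
      simp only [bsum, Finset.range_zero, Finset.sum_empty] at h3
      omega
    | succ p =>
      refine ⟨p, rfl, ?_, by omega⟩
      rw [bsum_back] at h3
      omega
  obtain ⟨p, hp, p1, p2⟩ := key _ _ h
  obtain ⟨q, hq, q1, q2⟩ := key _ _ h'
  have e : p = q := crossing_unique (fun p => bsum α A p (b - (p : ℝ) • α) + φ b + rk B b)
    (monotone_nat_of_le_succ fun n => by
      rw [bsum_back]; have := cnt_nonneg A (b - ((n + 1 : ℕ) : ℝ) • α); linarith)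
    (-1) p q p1 p2 q1 q2
  have e2 : n = n' := by omega
  subst e2
  have := rk_unique hA _ (-k) (-k') h.2.1 h'.2.1 (by rw [h.2.2, h'.2.2])
  exact ⟨rfl, neg_injective this⟩

lemma bwd_exists {d : ℕ} (α : Fin d → ℝ) {A B X : Set (Fin d → ℝ)} {φ : (Fin d → ℝ) → ℤ}
    (hA : Bornology.IsBounded A) (hB : Bornology.IsBounded B)
    (hXα : ∀ x ∈ X, ∀ n : ℤ, x + (n : ℝ) • α ∈ X)
    (hφp : ∀ x k, φ (x + zc k) = φ x)
    (hφ : ∀ x ∈ X, cnt A x + φ (x + α) = cnt B x + φ x)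
    (hφ0 : ∀ x ∈ X, φ x + cnt B x ≤ 0)
    {b : Fin d → ℝ} (hb : b ∈ X) (hbB : b ∈ B) (N : ℕ)
    (hN : 0 ≤ bsum α A N (b - (N : ℝ) • α) + φ b) :
    ∃ n k, n < N + 1 ∧ b - (n : ℝ) • α + zc (-k) ∈ piece α A B φ n k := by
  have h6 := hφ0 b hb
  have h7 := rk_lt hB hbB
  have h8 := rk_nonneg B b
  obtain ⟨p, hp, h1, h2⟩ := crossing (fun p => bsum α A p (b - (p : ℝ) • α) + φ b + rk B b) (-1) N
    (by simp only [bsum, Finset.range_zero, Finset.sum_empty]; omega) (by omega)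
  have h9 := bsum_back α A p b
  obtain ⟨k, hk, hk2⟩ := rk_exists hA (b - ((p + 1 : ℕ) : ℝ) • α)
    (bsum α A (p + 1) (b - ((p + 1 : ℕ) : ℝ) • α) + φ b + rk B b) (by omega) (by omega)
  refine ⟨p + 1, -k, by omega, ?_⟩
  rw [piece_back α hXα hφp hφ _ _ _ hb, neg_neg]
  exact ⟨hbB, hk, hk2⟩

lemma good_set {d : ℕ} (α : Fin d → ℝ) (X₀ : Set (Fin d → ℝ)) (h : volume X₀ᶜ = 0) :
    ∃ X ⊆ X₀, volume Xᶜ = 0 ∧ (∀ x ∈ X, ∀ n : ℤ, x + (n : ℝ) • α ∈ X) ∧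
      (∀ x ∈ X, ∀ k, x + zc k ∈ X) := by
  refine ⟨{x | ∀ p : ℤ × (Fin d → ℤ), x + (p.1 : ℝ) • α + zc p.2 ∈ X₀}, ?_, ?_, ?_, ?_⟩
  · intro x hx
    have := hx (0, 0)
    have z : zc (0 : Fin d → ℤ) = 0 := by ext i; simp [zc]
    simpa [z] using this
  · have : {x | ∀ p : ℤ × (Fin d → ℤ), x + (p.1 : ℝ) • α + zc p.2 ∈ X₀}ᶜ =
        ⋃ p : ℤ × (Fin d → ℤ), (fun x => x + ((p.1 : ℝ) • α + zc p.2)) ⁻¹' X₀ᶜ := by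
      ext x; simp [add_assoc]
    rw [this, measure_iUnion_null_iff]
    intro p
    rw [measure_preimage_add_right]
    exact h
  · intro x hx n p
    have := hx (n + p.1, p.2)
    convert this using 2
    push_cast
    rw [add_smul]; abel
  · intro x hx k p
    have := hx (p.1, k + p.2)
    convert this using 1
    rw [zc_add]; abel

lemma brs_core {d : ℕ} (α : Fin d → ℝ) (A B : Set (Fin d → ℝ))
    (hA : Bornology.IsBounded A) (hB : Bornology.IsBounded B)
    (hAm : MeasurableSet A) (hBm : MeasurableSet B) (m C : ℝ) (hm : 0 < m)
    (X : Set (Fin d → ℝ)) (hX : volume Xᶜ = 0)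
    (hXα : ∀ x ∈ X, ∀ n : ℤ, x + (n : ℝ) • α ∈ X)
    (hAb : ∀ x ∈ X, ∀ n : ℕ, |(bsum α A n x : ℝ) - n * m| ≤ C)
    (hBb : ∀ x ∈ X, ∀ n : ℕ, |(bsum α B n x : ℝ) - n * m| ≤ C) :
    EquidecompUpToNullMeasPieces A B
      {v : Fin d → ℝ | ∃ (n : ℤ) (m : Fin d → ℤ), v = (n : ℝ) • α + fun i => (m i : ℝ)} := by
  obtain ⟨φ, M, hφm, hφp, hφ, hφ0, hφM⟩ := exists_transfer α hA hAm hB hBm m C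
    (fun x hx => by simpa using hXα x hx 1) hAb hBb
  obtain ⟨N, hN⟩ := exists_nat_gt ((m + 2 * C + M) / m)
  rw [div_lt_iff₀ hm] at hN
  obtain ⟨RA, hRA⟩ := hA.exists_norm_le
  obtain ⟨RB, hRB⟩ := hB.exists_norm_le
  have hfin : {k : Fin d → ℤ | ‖zc k‖ ≤ RB + RA + (N + 1) * ‖α‖}.Finite := zc_finite _
  set I : Finset (ℕ × (Fin d → ℤ)) := Finset.range (N + 1) ×ˢ hfin.toFinset with hI
  have hmemI : ∀ n k a, n < N + 1 → a ∈ piece α A B φ n k → (n, k) ∈ I := by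
    intro n k a hn ha
    simp only [hI, Finset.mem_product, Finset.mem_range, hn, true_and, Set.Finite.mem_toFinset,
      Set.mem_ofPred_eq]
    have h1 := hRA _ ha.1
    have h2 := hRB _ ha.2.1
    have e : zc k = (a + (n : ℝ) • α + zc k) - a - (n : ℝ) • α := by abel
    have h3 : ‖(n : ℝ) • α‖ ≤ (N + 1) * ‖α‖ := by
      rw [norm_smul]
      gcongr
      simp only [Real.norm_natCast]
      exact_mod_cast hn.le
    rw [e]
    have h4 := norm_sub_le ((a + (n : ℝ) • α + zc k) - a) ((n : ℝ) • α)
    have h5 := norm_sub_le (a + (n : ℝ) • α + zc k) a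
    linarith
  have hfwd : ∀ a ∈ A, a ∈ X → ∃ n k, (n, k) ∈ I ∧ a ∈ piece α A B φ n k := by
    intro a ha haX
    have h1 := abs_le.1 (hBb a haX N)
    have h2 := abs_le.1 (hAb a haX 1)
    have e2 : bsum α A 1 a = cnt A a := by simp [bsum]
    rw [e2] at h2
    have h3 : (-M : ℝ) ≤ φ a := by exact_mod_cast hφM a haX
    have h4 : (rk A a : ℝ) < cnt A a := by exact_mod_cast rk_lt hA ha
    have h5 : (rk A a : ℝ) < bsum α B N a + φ a := by
      push_cast at h2
      linarith
    obtain ⟨n, k, hn, hp⟩ := fwd_exists α hB (φ := φ) ha N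
      (by have := hφ0 a haX; have := cnt_nonneg B a; omega) (by exact_mod_cast h5)
    exact ⟨n, k, hmemI n k a (by omega) hp, hp⟩
  have hbwd : ∀ b ∈ B, b ∈ X → ∃ n k, (n, k) ∈ I ∧
      b - (n : ℝ) • α + zc (-k) ∈ piece α A B φ n k := by
    intro b hb hbX
    have hx : b - (N : ℝ) • α ∈ X := by
      have := hXα b hbX (-N)
      simpa [sub_eq_add_neg] using this
    have h1 := abs_le.1 (hAb _ hx N)
    have h3 : (-M : ℝ) ≤ φ b := by exact_mod_cast hφM b hbX
    have hC : 0 ≤ C := (abs_nonneg _).trans (hAb _ hx N)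
    have h5 : (0 : ℝ) ≤ bsum α A N (b - (N : ℝ) • α) + φ b := by
      linarith
    obtain ⟨n, k, hn, hp⟩ := bwd_exists α hA hB hXα hφp hφ hφ0 hbX hb N (by exact_mod_cast h5)
    exact ⟨n, k, hmemI n k _ hn hp, hp⟩
  let e := I.equivFin
  have hmv : ∀ (n : ℕ) (k : Fin d → ℤ) (b : Fin d → ℝ),
      b ∈ ((n : ℝ) • α + zc k) +ᵥ piece α A B φ n k ↔
        b - (n : ℝ) • α + zc (-k) ∈ piece α A B φ n k := by
    intro n k b
    rw [Set.mem_vadd_set_iff_neg_vadd_mem, vadd_eq_add]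
    have : -((n : ℝ) • α + zc k) + b = b - (n : ℝ) • α + zc (-k) := by rw [zc_neg]; abel
    rw [this]
  refine ⟨I.card, fun j => piece α A B φ (e.symm j).1.1 (e.symm j).1.2,
    fun j => (((e.symm j).1.1 : ℕ) : ℝ) • α + zc (e.symm j).1.2, X, hX, ?_, ?_, ⟨?_, ?_⟩, ⟨?_, ?_⟩⟩
  · exact fun j => measurableSet_piece α hA hAm hB hBm hφm _ _
  · exact fun j => ⟨(e.symm j).1.1, (e.symm j).1.2, by simp; rfl⟩
  · ext a
    simp only [Set.mem_iUnion, Set.mem_inter_iff]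
    constructor
    · rintro ⟨j, hj, hjX⟩
      exact ⟨hj.1, hjX⟩
    · rintro ⟨ha, haX⟩
      obtain ⟨n, k, hi, hp⟩ := hfwd a ha haX
      refine ⟨e ⟨(n, k), hi⟩, ?_, haX⟩
      simpa using hp
  · intro i j hij
    refine Set.disjoint_left.2 fun a ha ha' => hij ?_
    have := fwd_unique α hB ha.1 ha'.1
    exact e.symm.injective (Subtype.ext (Prod.ext this.1 this.2))
  · ext b
    simp only [Set.mem_iUnion, Set.mem_inter_iff, hmv]
    constructor
    · rintro ⟨j, hj, hjX⟩
      exact ⟨((piece_back α hXα hφp hφ _ _ _ hjX).1 hj).1, hjX⟩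
    · rintro ⟨hb, hbX⟩
      obtain ⟨n, k, hi, hp⟩ := hbwd b hb hbX
      refine ⟨e ⟨(n, k), hi⟩, ?_, hbX⟩
      simpa using hp
  · intro i j hij
    refine Set.disjoint_left.2 fun b hb hb' => hij ?_
    have := bwd_unique α hA hB hXα hφp hφ hφ0 hb.2 ((hmv _ _ _).1 hb.1) ((hmv _ _ _).1 hb'.1)
    exact e.symm.injective (Subtype.ext (Prod.ext this.1 this.2))

/-- If `1, α_1, …, α_d` are linearly independent over `ℚ` and `A, B ⊆ ℝ^d` are bounded
remainder sets with respect to `α` of the same measure, then `A` and `B` are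
equidecomposable up to measure zero with measurable pieces using translations from
`ℤα + ℤ^d`. -/
theorem brs_equidecomposable {d : ℕ} (α : Fin d → ℝ)
    (hα : LinearIndependent ℚ (fun o : Option (Fin d) => o.elim (1 : ℝ) α))
    (A B : Set (Fin d → ℝ))
    (hAbd : Bornology.IsBounded A) (hBbd : Bornology.IsBounded B)
    (hAm : MeasurableSet A) (hBm : MeasurableSet B)
    (hABRS : IsBRS α A) (hBBRS : IsBRS α B)
    (hmes : volume A = volume B) :
    EquidecompUpToNullMeasPieces A B
      {v : Fin d → ℝ | ∃ (n : ℤ) (m : Fin d → ℤ), v = (n : ℝ) • α + fun i => (m i : ℝ)} := by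
  have hAfin : volume A ≠ ⊤ := hAbd.measure_lt_top.ne
  by_cases h0 : volume A = 0
  · refine ⟨0, Fin.elim0, Fin.elim0, (A ∪ B)ᶜ, ?_, fun j => j.elim0, fun j => j.elim0,
      ⟨?_, fun j => j.elim0⟩, ⟨?_, fun j => j.elim0⟩⟩
    · rw [compl_compl]
      exact measure_union_null h0 (hmes ▸ h0)
    · ext x; simp; tauto
    · ext x; simp; tauto
  · obtain ⟨C₁, h1⟩ := hABRS
    obtain ⟨C₂, h2⟩ := hBBRS
    rw [← hmes] at h2
    have hm : 0 < (volume A).toReal := ENNReal.toReal_pos h0 hAfin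
    set m := (volume A).toReal with hmdef
    set C := max 0 (max C₁ C₂) with hC
    have hae : ∀ᵐ x ∂(volume : Measure (Fin d → ℝ)), ∀ n : ℕ, 1 ≤ n →
        (|(bsum α A n x : ℝ) - n * m| ≤ C ∧ |(bsum α B n x : ℝ) - n * m| ≤ C) := by
      rw [ae_all_iff]
      intro n
      by_cases hn : 1 ≤ n
      · filter_upwards [h1 n hn, h2 n hn] with x hx1 hx2 _
        simp only [chiFun_eq hAbd, chiFun_eq hBbd] at hx1 hx2
        simp only [bsum, Int.cast_sum]
        exact ⟨hx1.trans ((le_max_left _ _).trans (le_max_right _ _)),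
          hx2.trans ((le_max_right _ _).trans (le_max_right _ _))⟩
      · exact Eventually.of_forall fun x h => absurd h hn
    obtain ⟨X, hXs, hX, hXα, -⟩ := good_set α _ (mem_ae_iff.1 hae)
    have hz : ∀ (D : Set (Fin d → ℝ)) (x : Fin d → ℝ), |(bsum α D 0 x : ℝ) - (0 : ℕ) * m| ≤ C := by
      intro D x; simp [bsum, hC]
    refine brs_core α A B hAbd hBbd hAm hBm m C hm X hX hXα ?_ ?_
    · intro x hx n
      rcases Nat.eq_zero_or_pos n with rfl | hn
      · exact hz A x
      · exact (hXs hx n hn).1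
    · intro x hx n
      rcases Nat.eq_zero_or_pos n with rfl | hn
      · exact hz B x
      · exact (hXs hx n hn).2
end

section
/- Let Γ be a lattice in ℝ × ℝ^d such that the projection p_1 restricted to Γ is injective and the image p_2(Γ) is dense in ℝ^d. Let W, W' ⊆ ℝ^d be two bounded Riemann measurable sets. If the one-dimensional model sets Λ(Γ, W) and Λ(Γ, W') are bounded distance equivalent, then W and W' are equidecomposable up to measure zero with Riemann measurable pieces, using only translations by vectors from p_2(Γ). -/
open Pointwise MeasureTheory

/-- A lattice in a real normed space: a discrete subgroup whose real span is everything. -/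
def IsLattice {E : Type*} [NormedAddCommGroup E] [NormedSpace ℝ E]
    (Γ : AddSubgroup E) : Prop :=
  DiscreteTopology Γ ∧ Submodule.span ℝ (Γ : Set E) = ⊤

/-- A bounded set with boundary of measure zero. -/
def RiemannMeasurable {d : ℕ} (A : Set (Fin d → ℝ)) : Prop :=
  Bornology.IsBounded A ∧ volume (frontier A) = 0

/-- The one-dimensional cut-and-project set `Λ(Γ, W) = { p₁(γ) : γ ∈ Γ, p₂(γ) ∈ W }`. -/
def modelSet {d : ℕ} (Γ : AddSubgroup (ℝ × (Fin d → ℝ))) (W : Set (Fin d → ℝ)) : Set ℝ :=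
  {x | ∃ γ ∈ Γ, γ.2 ∈ W ∧ γ.1 = x}

/-- Two point sets are bounded distance equivalent: there is a bijection
moving every point a distance at most `K` for some `K > 0`. -/
def BDEquiv {E : Type*} [MetricSpace E] (Λ Λ' : Set E) : Prop :=
  ∃ K : ℝ, 0 < K ∧ ∃ χ : Λ → Λ', Function.Bijective χ ∧ ∀ p : Λ, dist (χ p : E) (p : E) ≤ K

/-- `W, W'` are equidecomposable up to measure zero with Riemann measurable pieces,
using only translations by vectors in the set `H`. -/
def EquidecompUpToNullRiemannPieces {d : ℕ} (W W' : Set (Fin d → ℝ)) (H : Set (Fin d → ℝ)) :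
    Prop :=
  ∃ (k : ℕ) (P : Fin k → Set (Fin d → ℝ)) (h : Fin k → (Fin d → ℝ)) (X' : Set (Fin d → ℝ)),
    volume X'ᶜ = 0 ∧
    (∀ j, RiemannMeasurable (P j)) ∧ (∀ j, h j ∈ H) ∧
    IsPartitionOf (fun j => P j ∩ X') (W ∩ X') ∧
    IsPartitionOf (fun j => (h j +ᵥ P j) ∩ X') (W' ∩ X')

namespace BDEaux

open Set Filter Topology

variable {d : ℕ}

/-- lattice points with first coordinate in `I`, whose second coordinate translated by `x` is in `V` -/
def cp (Γ : AddSubgroup (ℝ × (Fin d → ℝ))) (V : Set (Fin d → ℝ)) (x : Fin d → ℝ) (I : Set ℝ) :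
    Set (ℝ × (Fin d → ℝ)) := {γ | γ ∈ Γ ∧ γ.1 ∈ I ∧ x + γ.2 ∈ V}

/-- discrepancy -/
noncomputable def D (Γ : AddSubgroup (ℝ × (Fin d → ℝ))) (W W' : Set (Fin d → ℝ))
    (x : Fin d → ℝ) (I : Set ℝ) : ℤ := ((cp Γ W x I).ncard : ℤ) - ((cp Γ W' x I).ncard : ℤ)

lemma finite_of_bounded {Γ : AddSubgroup (ℝ × (Fin d → ℝ))} (hΓ : IsLattice Γ)
    {S : Set (ℝ × (Fin d → ℝ))} (hS : S ⊆ Γ) (hb : Bornology.IsBounded S) : S.Finite := by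
  have := hΓ.1
  have := Metric.finite_isBounded_inter_isClosed (s := (Γ : Set (ℝ × (Fin d → ℝ))))
    (DiscreteTopology.isDiscrete) hb AddSubgroup.isClosed_of_discrete
  rwa [inter_eq_left.2 hS] at this

lemma countable_lattice {Γ : AddSubgroup (ℝ × (Fin d → ℝ))} (hΓ : IsLattice Γ) : Countable Γ := by
  have := hΓ.1
  exact countable_of_Lindelof_of_discrete

lemma finite_box {Γ : AddSubgroup (ℝ × (Fin d → ℝ))} (hΓ : IsLattice Γ) (a b R : ℝ) :
    {γ : ℝ × (Fin d → ℝ) | γ ∈ Γ ∧ γ.1 ∈ Icc a b ∧ ‖γ.2‖ ≤ R}.Finite := by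
  apply finite_of_bounded hΓ (fun γ h => h.1)
  refine ((Metric.isBounded_Icc a b).prod (Metric.isBounded_closedBall (x := (0 : Fin d → ℝ)) (r := R))).subset ?_
  rintro γ ⟨_, h1, h2⟩
  exact ⟨h1, by simpa using h2⟩

lemma cp_finite {Γ : AddSubgroup (ℝ × (Fin d → ℝ))} (hΓ : IsLattice Γ) {V : Set (Fin d → ℝ)}
    (hV : Bornology.IsBounded V) (x : Fin d → ℝ) {I : Set ℝ} (hI : Bornology.IsBounded I) :
    (cp Γ V x I).Finite := by
  obtain ⟨R, hR⟩ := hV.exists_norm_le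
  obtain ⟨r, hr⟩ := hI.exists_norm_le
  refine (finite_box hΓ (-r) r (R + ‖x‖)).subset ?_
  rintro γ ⟨h0, h1, h2⟩
  refine ⟨h0, abs_le.1 (hr _ h1), ?_⟩
  calc ‖γ.2‖ = ‖(x + γ.2) - x‖ := by congr 1; abel
    _ ≤ ‖x + γ.2‖ + ‖x‖ := norm_sub_le _ _
    _ ≤ _ := by gcongr; exact hR _ h2

lemma ncard_cp_union {Γ : AddSubgroup (ℝ × (Fin d → ℝ))} (hΓ : IsLattice Γ) {V : Set (Fin d → ℝ)}
    (hV : Bornology.IsBounded V) (x : Fin d → ℝ) {I J : Set ℝ} (hI : Bornology.IsBounded I)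
    (hJ : Bornology.IsBounded J) (hd : Disjoint I J) :
    (cp Γ V x (I ∪ J)).ncard = (cp Γ V x I).ncard + (cp Γ V x J).ncard := by
  rw [← ncard_union_eq _ (cp_finite hΓ hV x hI) (cp_finite hΓ hV x hJ)]
  · congr 1; ext γ; simp only [cp, mem_union, mem_ofPred_eq]; tauto
  · rw [Set.disjoint_left] at hd ⊢
    rintro γ h1 h2
    exact hd h1.2.1 h2.2.1

lemma D_union {Γ : AddSubgroup (ℝ × (Fin d → ℝ))} (hΓ : IsLattice Γ) {W W' : Set (Fin d → ℝ)}
    (hW : Bornology.IsBounded W) (hW' : Bornology.IsBounded W') (x : Fin d → ℝ) {I J : Set ℝ}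
    (hI : Bornology.IsBounded I) (hJ : Bornology.IsBounded J) (hd : Disjoint I J) :
    D Γ W W' x (I ∪ J) = D Γ W W' x I + D Γ W W' x J := by
  simp only [D, ncard_cp_union hΓ hW x hI hJ hd, ncard_cp_union hΓ hW' x hI hJ hd]
  push_cast; ring

lemma ncard_cp_shift {Γ : AddSubgroup (ℝ × (Fin d → ℝ))} (V : Set (Fin d → ℝ)) (x : Fin d → ℝ)
    {I J : Set ℝ} {δ : ℝ × (Fin d → ℝ)} (hδ : δ ∈ Γ) (h : ∀ t, t ∈ I ↔ t + δ.1 ∈ J) :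
    (cp Γ V (x + δ.2) I).ncard = (cp Γ V x J).ncard := by
  rw [← ncard_image_of_injective (cp Γ V (x + δ.2) I) (add_left_injective δ)]
  congr 1
  ext γ
  simp only [mem_image, cp, mem_ofPred_eq]
  constructor
  · rintro ⟨η, ⟨h1, h2, h3⟩, rfl⟩
    refine ⟨Γ.add_mem h1 hδ, (h _).1 h2, ?_⟩
    convert h3 using 1
    simp only [Prod.snd_add]; abel
  · rintro ⟨h1, h2, h3⟩
    refine ⟨γ - δ, ⟨Γ.sub_mem h1 hδ, (h _).2 (by simpa using h2), ?_⟩, by simp⟩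
    convert h3 using 1
    simp only [Prod.snd_sub]; abel

lemma D_shift {Γ : AddSubgroup (ℝ × (Fin d → ℝ))} (W W' : Set (Fin d → ℝ)) (x : Fin d → ℝ)
    {I J : Set ℝ} {δ : ℝ × (Fin d → ℝ)} (hδ : δ ∈ Γ) (h : ∀ t, t ∈ I ↔ t + δ.1 ∈ J) :
    D Γ W W' (x + δ.2) I = D Γ W W' x J := by
  simp only [D, ncard_cp_shift W x hδ h, ncard_cp_shift W' x hδ h]

/-- generic points -/
def gen (Γ : AddSubgroup (ℝ × (Fin d → ℝ))) (W W' : Set (Fin d → ℝ)) : Set (Fin d → ℝ) :=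
  {x | ∀ γ ∈ Γ, x + γ.2 ∉ frontier W ∧ x + γ.2 ∉ frontier W'}

lemma gen_compl_null {Γ : AddSubgroup (ℝ × (Fin d → ℝ))} (hΓ : IsLattice Γ)
    {W W' : Set (Fin d → ℝ)} (hW : volume (frontier W) = 0) (hW' : volume (frontier W') = 0) :
    volume (gen Γ W W')ᶜ = 0 := by
  have := countable_lattice hΓ
  have : (gen Γ W W')ᶜ ⊆ ⋃ γ : Γ, ((fun x => x + γ.1.2) ⁻¹' (frontier W) ∪
      (fun x => x + γ.1.2) ⁻¹' (frontier W')) := by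
    intro x hx
    simp only [gen, mem_compl_iff, mem_ofPred_eq, not_forall] at hx
    obtain ⟨γ, hγ, h⟩ := hx
    rw [mem_iUnion]
    refine ⟨⟨γ, hγ⟩, ?_⟩
    simp only [mem_union, mem_preimage]
    tauto
  refine measure_mono_null this (measure_iUnion_null fun γ => measure_union_null ?_ ?_)
  · rw [measure_preimage_add_right, hW]
  · rw [measure_preimage_add_right, hW']

lemma eventually_mem_iff {V : Set (Fin d → ℝ)} {y : Fin d → ℝ} (hy : y ∉ frontier V) :
    ∀ᶠ z in 𝓝 y, (z ∈ V ↔ y ∈ V) := by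
  by_cases h : y ∈ V
  · have : y ∈ interior V := by
      by_contra h'; exact hy ⟨subset_closure h, h'⟩
    filter_upwards [mem_interior_iff_mem_nhds.1 this] with z hz
    simp [hz, h]
  · have : y ∉ closure V := by
      intro h'; exact hy ⟨h', fun h'' => h (interior_subset h'')⟩
    filter_upwards [isClosed_closure.isOpen_compl.mem_nhds this] with z hz
    simp only [h, iff_false]; exact fun h => hz (subset_closure h)

lemma not_mem_frontier {V : Set (Fin d → ℝ)} {y : Fin d → ℝ} (h : ∀ᶠ z in 𝓝 y, (z ∈ V ↔ y ∈ V)) :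
    y ∉ frontier V := by
  by_cases hy : y ∈ V
  · have : y ∈ interior V := by
      rw [mem_interior_iff_mem_nhds]; filter_upwards [h] with z hz; exact hz.2 hy
    exact fun h => h.2 this
  · intro hf
    have := mem_closure_iff_frequently.1 hf.1
    exact this (h.mono fun z hz hz' => hy (hz.1 hz'))

lemma loc_const {Γ : AddSubgroup (ℝ × (Fin d → ℝ))} (hΓ : IsLattice Γ) {V : Set (Fin d → ℝ)}
    (hV : Bornology.IsBounded V) {x : Fin d → ℝ} (hx : ∀ γ ∈ Γ, x + γ.2 ∉ frontier V) (a b : ℝ) :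
    ∀ᶠ y in 𝓝 x, ∀ I ⊆ Icc a b, cp Γ V y I = cp Γ V x I := by
  obtain ⟨R, hR⟩ := hV.exists_norm_le
  have hfin := finite_box hΓ a b (R + (‖x‖ + 1))
  have h1 : ∀ᶠ y in 𝓝 x, ∀ γ ∈ {γ : ℝ × (Fin d → ℝ) | γ ∈ Γ ∧ γ.1 ∈ Icc a b ∧ ‖γ.2‖ ≤ R + (‖x‖ + 1)},
      (y + γ.2 ∈ V ↔ x + γ.2 ∈ V) := by
    rw [Filter.eventually_all_finite hfin]
    rintro γ ⟨h0, -, -⟩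
    have hc : Tendsto (fun y => y + γ.2) (𝓝 x) (𝓝 (x + γ.2)) :=
      (continuous_id.add continuous_const).tendsto x
    exact hc.eventually (eventually_mem_iff (hx γ h0))
  filter_upwards [h1, Metric.ball_mem_nhds x one_pos] with y hy hyx I hI
  have hny : ‖y‖ ≤ ‖x‖ + 1 := by
    have : ‖y - x‖ < 1 := by simpa [dist_eq_norm] using hyx
    have := norm_le_norm_add_norm_sub x y
    rw [norm_sub_rev] at this
    linarith
  have key : ∀ z : Fin d → ℝ, ‖z‖ ≤ ‖x‖ + 1 → ∀ γ : ℝ × (Fin d → ℝ), z + γ.2 ∈ V →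
      ‖γ.2‖ ≤ R + (‖x‖ + 1) := by
    intro z hz γ h
    calc ‖γ.2‖ = ‖(z + γ.2) - z‖ := by congr 1; abel
      _ ≤ ‖z + γ.2‖ + ‖z‖ := norm_sub_le _ _
      _ ≤ _ := by gcongr; exact hR _ h
  ext γ
  simp only [cp, mem_ofPred_eq]
  constructor
  · rintro ⟨h0, h1, h2⟩
    exact ⟨h0, h1, (hy γ ⟨h0, hI h1, key y hny γ h2⟩).1 h2⟩
  · rintro ⟨h0, h1, h2⟩
    exact ⟨h0, h1, (hy γ ⟨h0, hI h1, key x (by linarith) γ h2⟩).2 h2⟩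

lemma D_loc_const {Γ : AddSubgroup (ℝ × (Fin d → ℝ))} (hΓ : IsLattice Γ) {W W' : Set (Fin d → ℝ)}
    (hW : Bornology.IsBounded W) (hW' : Bornology.IsBounded W')
    {x : Fin d → ℝ} (hx : x ∈ gen Γ W W') (a b : ℝ) :
    ∀ᶠ y in 𝓝 x, ∀ I ⊆ Icc a b, D Γ W W' y I = D Γ W W' x I := by
  filter_upwards [loc_const hΓ hW (fun γ h => (hx γ h).1) a b,
    loc_const hΓ hW' (fun γ h => (hx γ h).2) a b] with y h1 h2 I hI
  simp only [D, h1 I hI, h2 I hI]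

/-- recurrence -/
lemma exists_return {Γ : AddSubgroup (ℝ × (Fin d → ℝ))} (hΓ : IsLattice Γ)
    (hinj : Set.InjOn Prod.fst (Γ : Set (ℝ × (Fin d → ℝ))))
    (hdense : Dense (Prod.snd '' (Γ : Set (ℝ × (Fin d → ℝ))))) (R : ℝ) {ε : ℝ} (hε : 0 < ε) :
    ∃ η ∈ Γ, R < η.1 ∧ ‖η.2‖ < ε := by
  suffices h : ∃ η ∈ Γ, |R| < |η.1| ∧ ‖η.2‖ < ε by
    obtain ⟨η, h0, h1, h2⟩ := h
    rcases le_total 0 η.1 with h | h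
    · exact ⟨η, h0, by rw [abs_of_nonneg h] at h1; exact (le_abs_self R).trans_lt h1, h2⟩
    · exact ⟨-η, Γ.neg_mem h0, by rw [abs_of_nonpos h] at h1; exact (le_abs_self R).trans_lt h1,
        by simpa using h2⟩
  rcases subsingleton_or_nontrivial (Fin d → ℝ) with hs | hn
  · obtain ⟨γ, hγ, hne⟩ : ∃ γ ∈ Γ, γ.1 ≠ 0 := by
      by_contra! hc
      have h0 : (Γ : Set (ℝ × (Fin d → ℝ))) ⊆ {0} := by
        intro γ hγ
        exact hinj hγ Γ.zero_mem (by simpa using hc γ hγ)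
      have h1 : Submodule.span ℝ (Γ : Set (ℝ × (Fin d → ℝ))) = ⊥ := by
        rw [Submodule.span_eq_bot]; intro x hx; exact h0 hx
      rw [hΓ.2] at h1
      exact top_ne_bot h1
    obtain ⟨n, hn⟩ := exists_nat_gt (|R| / |γ.1|)
    refine ⟨n • γ, Γ.nsmul_mem hγ n, ?_, ?_⟩
    · rw [div_lt_iff₀ (abs_pos.2 hne)] at hn
      simpa [abs_mul] using hn
    · rw [Subsingleton.elim (n • γ).2 0]; simpa using hε
  · by_contra! hc
    have hfin := (finite_box hΓ (-|R|) |R| ε).image Prod.snd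
    have hfin2 : (Metric.ball (0 : Fin d → ℝ) ε ∩ Prod.snd '' (Γ : Set (ℝ × (Fin d → ℝ)))).Finite := by
      refine hfin.subset ?_
      rintro _ ⟨hb, γ, hγ, rfl⟩
      have hb' : ‖γ.2‖ < ε := by simpa using hb
      refine ⟨γ, ⟨hγ, ?_, hb'.le⟩, rfl⟩
      have : |γ.1| ≤ |R| := by
        by_contra! h; exact absurd (hc γ hγ h) (not_le.2 hb')
      exact abs_le.1 this
    have hsub := hdense.open_subset_closure_inter (Metric.isOpen_ball (x := (0 : Fin d → ℝ)) (ε := ε))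
    rw [hfin2.isClosed.closure_eq] at hsub
    have : NeBot (𝓝[≠] (0 : Fin d → ℝ)) := Module.punctured_nhds_neBot ℝ _ 0
    exact infinite_of_mem_nhds (0 : Fin d → ℝ) (Metric.ball_mem_nhds 0 hε) (hfin2.subset hsub)

lemma exists_visit {Γ : AddSubgroup (ℝ × (Fin d → ℝ))} (hΓ : IsLattice Γ)
    (hinj : Set.InjOn Prod.fst (Γ : Set (ℝ × (Fin d → ℝ))))
    (hdense : Dense (Prod.snd '' (Γ : Set (ℝ × (Fin d → ℝ))))) (R : ℝ) (x : Fin d → ℝ)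
    {U : Set (Fin d → ℝ)} {x0 : Fin d → ℝ} (hU : U ∈ 𝓝 x0) :
    ∃ γ ∈ Γ, R < γ.1 ∧ U ∈ 𝓝 (x + γ.2) := by
  obtain ⟨ε, hε, hb⟩ := Metric.mem_nhds_iff.1 hU
  obtain ⟨_, ⟨γ, hγ, rfl⟩, h1⟩ := hdense.exists_dist_lt (x0 - x) (half_pos hε)
  obtain ⟨η, hη, h2, h3⟩ := exists_return hΓ hinj hdense (R - γ.1) (half_pos hε)
  refine ⟨γ + η, Γ.add_mem hγ hη, by simp only [Prod.fst_add]; linarith, ?_⟩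
  refine mem_of_superset (Metric.isOpen_ball.mem_nhds ?_) hb
  rw [Metric.mem_ball, dist_comm, dist_eq_norm]
  rw [dist_eq_norm] at h1
  calc ‖x0 - (x + (γ + η).2)‖ = ‖(x0 - x - γ.2) - η.2‖ := by congr 1; simp only [Prod.snd_add]; abel
    _ ≤ ‖x0 - x - γ.2‖ + ‖η.2‖ := norm_sub_le _ _
    _ < ε := by linarith

lemma window_bound {Γ : AddSubgroup (ℝ × (Fin d → ℝ))} (hΓ : IsLattice Γ) {V : Set (Fin d → ℝ)}
    (hV : Bornology.IsBounded V) (K : ℝ) :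
    ∃ C : ℕ, ∀ x a, (cp Γ V x (Icc a (a + K))).ncard ≤ C := by
  obtain ⟨R, hR⟩ := hV.exists_norm_le
  have hfin := finite_box hΓ (-K) K (R + R)
  refine ⟨{γ : ℝ × (Fin d → ℝ) | γ ∈ Γ ∧ γ.1 ∈ Icc (-K) K ∧ ‖γ.2‖ ≤ R + R}.ncard, fun x a => ?_⟩
  · rcases (cp Γ V x (Icc a (a + K))).eq_empty_or_nonempty with h | ⟨γ0, h0⟩
    · rw [h, ncard_empty]; exact Nat.zero_le _
    refine ncard_le_ncard_of_injOn (fun γ => γ - γ0) ?_ (fun _ _ _ _ h => by simpa using h) hfin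
    rintro γ h
    refine ⟨Γ.sub_mem h.1 h0.1, ?_, ?_⟩
    · have := h.2.1; have := h0.2.1
      simp only [mem_Icc, Prod.fst_sub] at *
      constructor <;> linarith
    · calc ‖(γ - γ0).2‖ = ‖(x + γ.2) - (x + γ0.2)‖ := by congr 1; simp only [Prod.snd_sub]; abel
        _ ≤ ‖x + γ.2‖ + ‖x + γ0.2‖ := norm_sub_le _ _
        _ ≤ _ := add_le_add (hR _ h.2.2) (hR _ h0.2.2)

lemma bound_zero {Γ : AddSubgroup (ℝ × (Fin d → ℝ))} (hΓ : IsLattice Γ)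
    (hinj : Set.InjOn Prod.fst (Γ : Set (ℝ × (Fin d → ℝ)))) {W W' : Set (Fin d → ℝ)}
    (hW' : Bornology.IsBounded W')
    (hbde : BDEquiv (modelSet Γ W) (modelSet Γ W')) :
    ∃ C : ℤ, ∀ a b, a ≤ b → D Γ W W' 0 (Ico a b) ≤ C := by
  obtain ⟨K, hK, χ, hχ, hd⟩ := hbde
  obtain ⟨C, hC⟩ := window_bound hΓ hW' K
  refine ⟨2 * C, fun a b hab => ?_⟩
  have hex : ∀ γ ∈ cp Γ W 0 (Ico a b), ∃ γ' ∈ Γ, γ'.2 ∈ W' ∧ ∃ h : γ.1 ∈ modelSet Γ W,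
      γ'.1 = (χ ⟨γ.1, h⟩ : ℝ) := by
    rintro γ ⟨h0, h1, h2⟩
    have h : γ.1 ∈ modelSet Γ W := ⟨γ, h0, by simpa using h2, rfl⟩
    obtain ⟨γ', h3, h4, h5⟩ := (χ ⟨γ.1, h⟩).2
    exact ⟨γ', h3, h4, h, h5⟩
  choose! g hg using hex
  have hf := fun (a b : ℝ) => cp_finite hΓ hW' 0 (Metric.isBounded_Icc a b)
  have h1 : (cp Γ W 0 (Ico a b)).ncard ≤
      (cp Γ W' 0 (Ico a b) ∪ (cp Γ W' 0 (Icc (a - K) (a - K + K)) ∪ cp Γ W' 0 (Icc b (b + K)))).ncard := by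
    refine ncard_le_ncard_of_injOn g ?_ ?_ ?_
    · intro γ hγ
      obtain ⟨h0, h1, h, h2⟩ := hg γ hγ
      have h3 := hd ⟨γ.1, h⟩
      rw [← h2, Real.dist_eq, abs_le] at h3
      simp only at h3
      have h4 := hγ.2.1
      simp only [cp, mem_union, mem_ofPred_eq, h0, zero_add, h1, true_and, and_true, mem_Icc, mem_Ico]
      rw [mem_Ico] at h4
      by_cases h5 : (g γ).1 < a
      · right; left; constructor <;> linarith
      · by_cases h6 : (g γ).1 < b
        · left; constructor <;> linarith
        · right; right; constructor <;> linarith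
    · intro γ hγ γ' hγ' he
      obtain ⟨h0, h1, h, h2⟩ := hg γ hγ
      obtain ⟨h0', h1', h', h2'⟩ := hg γ' hγ'
      rw [he, h2'] at h2
      have := hχ.1 (Subtype.ext h2)
      exact hinj hγ.1 hγ'.1 (by simpa using (congrArg Subtype.val this).symm)
    · exact (cp_finite hΓ hW' 0 (Metric.isBounded_Ico a b)).union ((hf _ _).union (hf _ _))
  have h2 := h1.trans ((ncard_union_le _ _).trans (Nat.add_le_add_left (ncard_union_le _ _) _))
  have h3 := hC 0 (a - K)
  have h4 := hC 0 b
  simp only [D]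
  omega

lemma bound_gen {Γ : AddSubgroup (ℝ × (Fin d → ℝ))} (hΓ : IsLattice Γ)
    (hinj : Set.InjOn Prod.fst (Γ : Set (ℝ × (Fin d → ℝ))))
    (hdense : Dense (Prod.snd '' (Γ : Set (ℝ × (Fin d → ℝ))))) {W W' : Set (Fin d → ℝ)}
    (hW : Bornology.IsBounded W) (hW' : Bornology.IsBounded W')
    (hbde : BDEquiv (modelSet Γ W) (modelSet Γ W')) :
    ∃ C : ℤ, ∀ x ∈ gen Γ W W', ∀ a b, a ≤ b → D Γ W W' x (Ico a b) ≤ C := by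
  obtain ⟨C, hC⟩ := bound_zero hΓ hinj hW' hbde
  refine ⟨C, fun x hx a b hab => ?_⟩
  obtain ⟨γ, hγ, -, h⟩ := exists_visit hΓ hinj hdense 0 0 (D_loc_const hΓ hW hW' hx a b)
  have h1 := mem_of_mem_nhds h (Ico a b) Ico_subset_Icc_self
  rw [← h1, D_shift W W' 0 hγ (J := Ico (a + γ.1) (b + γ.1)) (by intro t; simp)]
  exact hC _ _ (by linarith)

/-- rounding down to an actual point -/
lemma rounding {Γ : AddSubgroup (ℝ × (Fin d → ℝ))} (hΓ : IsLattice Γ)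
    {W W' : Set (Fin d → ℝ)} (hW : Bornology.IsBounded W) (hW' : Bornology.IsBounded W')
    {x : Fin d → ℝ} (hx : x ∈ W) {J : Set ℝ} {T : ℝ} (h0 : (0 : ℝ) ∈ J) (hJ : J ⊆ Icc 0 T)
    (hl : ∀ t ∈ J, Icc 0 t ⊆ J) :
    ∃ γ ∈ cp Γ (W ∪ W') x J, D Γ W W' x J = D Γ W W' x (Icc 0 γ.1) := by
  have hfin := cp_finite hΓ (hW.union hW') x ((Metric.isBounded_Icc 0 T).subset hJ)
  obtain ⟨γ, hγ, hmax⟩ := hfin.exists_maximalFor Prod.fst _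
    ⟨0, Γ.zero_mem, h0, by simpa using Or.inl hx⟩
  refine ⟨γ, hγ, ?_⟩
  have key : ∀ V ⊆ W ∪ W', cp Γ V x J = cp Γ V x (Icc 0 γ.1) := by
    intro V hV
    ext η
    constructor
    · rintro ⟨h1, h2, h3⟩
      refine ⟨h1, ⟨(hJ h2).1, ?_⟩, h3⟩
      by_contra! hlt
      exact absurd (hmax ⟨h1, h2, hV h3⟩ hlt.le) (not_le.2 hlt)
    · rintro ⟨h1, h2, h3⟩
      exact ⟨h1, hl _ hγ.2.1 h2, h3⟩
  simp only [D, key W subset_union_left, key W' subset_union_right]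

/-- points of `W` whose matched partner is `γ` -/
def piece (Γ : AddSubgroup (ℝ × (Fin d → ℝ))) (W W' : Set (Fin d → ℝ))
    (γ : ℝ × (Fin d → ℝ)) : Set (Fin d → ℝ) :=
  {x | x ∈ W ∧ D Γ W W' x (Icc 0 γ.1) ≤ 0 ∧ ∀ t, 0 ≤ t → t < γ.1 → 0 < D Γ W W' x (Icc 0 t)}

lemma piece_riemann {Γ : AddSubgroup (ℝ × (Fin d → ℝ))} (hΓ : IsLattice Γ)
    {W W' : Set (Fin d → ℝ)} (hW : RiemannMeasurable W) (hW' : RiemannMeasurable W')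
    (γ : ℝ × (Fin d → ℝ)) : RiemannMeasurable (piece Γ W W' γ) := by
  refine ⟨hW.1.subset fun x hx => hx.1, ?_⟩
  refine measure_mono_null ?_ (gen_compl_null hΓ hW.2 hW'.2)
  intro x hx hg
  refine not_mem_frontier ?_ hx
  filter_upwards [D_loc_const hΓ hW.1 hW'.1 hg 0 γ.1,
    eventually_mem_iff (by simpa using (hg 0 Γ.zero_mem).1)] with y h1 h2
  have h3 : ∀ t, t < γ.1 → D Γ W W' y (Icc 0 t) = D Γ W W' x (Icc 0 t) := fun t ht =>
    h1 _ (Icc_subset_Icc_right ht.le)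
  simp only [piece, mem_ofPred_eq, h2, h1 _ subset_rfl]
  refine and_congr_right fun _ => and_congr_right fun _ => ?_
  refine forall_congr' fun t => forall_congr' fun _ => forall_congr' fun ht => ?_
  rw [h3 t ht]

lemma D_Ico_pos {Γ : AddSubgroup (ℝ × (Fin d → ℝ))} (hΓ : IsLattice Γ)
    {W W' : Set (Fin d → ℝ)} (hW : Bornology.IsBounded W) (hW' : Bornology.IsBounded W')
    {γ : ℝ × (Fin d → ℝ)} {x : Fin d → ℝ} (hx : x ∈ piece Γ W W' γ) {s : ℝ} (h0 : 0 < s)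
    (hs : s ≤ γ.1) : 0 < D Γ W W' x (Ico 0 s) := by
  obtain ⟨η, hη, he⟩ := rounding (Γ := Γ) hΓ hW hW' hx.1 (J := Ico 0 s) (T := s) ⟨le_rfl, h0⟩
    Ico_subset_Icc_self (fun t ht u hu => ⟨hu.1, hu.2.trans_lt ht.2⟩)
  rw [he]
  exact hx.2.2 _ hη.2.1.1 (hη.2.1.2.trans_le hs)

lemma ncard_cp_singleton {Γ : AddSubgroup (ℝ × (Fin d → ℝ))}
    (hinj : Set.InjOn Prod.fst (Γ : Set (ℝ × (Fin d → ℝ)))) (V : Set (Fin d → ℝ)) (x : Fin d → ℝ)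
    {γ : ℝ × (Fin d → ℝ)} (hγ : γ ∈ Γ) :
    (x + γ.2 ∈ V → (cp Γ V x {γ.1}).ncard = 1) ∧ (x + γ.2 ∉ V → (cp Γ V x {γ.1}).ncard = 0) := by
  constructor
  · intro h
    rw [ncard_eq_one]
    refine ⟨γ, ?_⟩
    ext η
    constructor
    · rintro ⟨h1, h2, h3⟩
      exact hinj h1 hγ h2
    · rintro rfl; exact ⟨hγ, rfl, h⟩
  · intro h
    have : cp Γ V x {γ.1} = ∅ := by
      ext η
      simp only [mem_empty_iff_false, iff_false]
      rintro ⟨h1, h2, h3⟩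
      rw [hinj h1 hγ h2] at h3
      exact h h3
    rw [this, ncard_empty]

lemma piece_key {Γ : AddSubgroup (ℝ × (Fin d → ℝ))} (hΓ : IsLattice Γ)
    (hinj : Set.InjOn Prod.fst (Γ : Set (ℝ × (Fin d → ℝ))))
    {W W' : Set (Fin d → ℝ)} (hW : Bornology.IsBounded W) (hW' : Bornology.IsBounded W')
    {γ : ℝ × (Fin d → ℝ)} (hγ : γ ∈ Γ) (hpos : 0 ≤ γ.1)
    {x : Fin d → ℝ} (hx : x ∈ piece Γ W W' γ) :
    x + γ.2 ∈ W' ∧ D Γ W W' x (Icc 0 γ.1) = 0 := by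
  have hle := hx.2.1
  obtain ⟨a1, a2⟩ := ncard_cp_singleton hinj W x hγ
  obtain ⟨b1, b2⟩ := ncard_cp_singleton hinj W' x hγ
  rcases hpos.eq_or_lt with h | h
  · have hz : γ = 0 := hinj hγ Γ.zero_mem h.symm
    have hw : x + γ.2 ∈ W := by simpa [hz] using hx.1
    have hi : Icc 0 γ.1 = {γ.1} := by rw [← h]; simp
    rw [hi] at hle ⊢
    simp only [D] at hle ⊢
    by_cases hw' : x + γ.2 ∈ W'
    · exact ⟨hw', by rw [a1 hw, b1 hw']; simp⟩
    · rw [a1 hw, b2 hw'] at hle; simp at hle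
  · have h1 := D_Ico_pos hΓ hW hW' hx h le_rfl
    have h2 : D Γ W W' x (Icc 0 γ.1) = D Γ W W' x (Ico 0 γ.1) + D Γ W W' x {γ.1} := by
      rw [← D_union hΓ hW hW' x (Metric.isBounded_Ico _ _) Bornology.isBounded_singleton (by simp),
        Ico_union_right hpos]
    by_cases hw' : x + γ.2 ∈ W'
    · refine ⟨hw', ?_⟩
      have h3 := b1 hw'
      have h4 : D Γ W W' x {γ.1} = ((cp Γ W x {γ.1}).ncard : ℤ) - ((cp Γ W' x {γ.1}).ncard : ℤ) := rfl
      omega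
    · have h3 := b2 hw'
      have h4 : D Γ W W' x {γ.1} = ((cp Γ W x {γ.1}).ncard : ℤ) - ((cp Γ W' x {γ.1}).ncard : ℤ) := rfl
      omega

lemma piece_disjoint {Γ : AddSubgroup (ℝ × (Fin d → ℝ))}
    (hinj : Set.InjOn Prod.fst (Γ : Set (ℝ × (Fin d → ℝ)))) {W W' : Set (Fin d → ℝ)}
    {γ γ' : ℝ × (Fin d → ℝ)} (hγ : γ ∈ Γ) (hpos : 0 ≤ γ.1) (hγ' : γ' ∈ Γ) (hpos' : 0 ≤ γ'.1)
    {x : Fin d → ℝ} (hx : x ∈ piece Γ W W' γ) (hx' : x ∈ piece Γ W W' γ') : γ = γ' := by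
  rcases lt_trichotomy γ.1 γ'.1 with h | h | h
  · exact absurd (hx'.2.2 _ hpos h) (not_lt.2 hx.2.1)
  · exact hinj hγ hγ' h
  · exact absurd (hx.2.2 _ hpos' h) (not_lt.2 hx'.2.1)

lemma image_disjoint_aux {Γ : AddSubgroup (ℝ × (Fin d → ℝ))} (hΓ : IsLattice Γ)
    (hinj : Set.InjOn Prod.fst (Γ : Set (ℝ × (Fin d → ℝ))))
    {W W' : Set (Fin d → ℝ)} (hW : Bornology.IsBounded W) (hW' : Bornology.IsBounded W')
    {γ γ' : ℝ × (Fin d → ℝ)} (hγ : γ ∈ Γ) (hγ' : γ' ∈ Γ) (hpos' : 0 ≤ γ'.1)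
    (hlt : γ'.1 < γ.1)
    {x y : Fin d → ℝ} (hx : x ∈ piece Γ W W' γ) (hy : y ∈ piece Γ W W' γ')
    (he : x + γ.2 = y + γ'.2) : False := by
  have hδ : γ - γ' ∈ Γ := Γ.sub_mem hγ hγ'
  have hy' : y = x + (γ - γ').2 := by
    have : y = x + γ.2 - γ'.2 := by rw [he]; abel
    rw [this, Prod.snd_sub]; abel
  have h1 := (piece_key hΓ hinj hW hW' hγ (hpos'.trans hlt.le) hx).2
  have h2 := (piece_key hΓ hinj hW hW' hγ' hpos' hy).2
  have h3 := D_Ico_pos hΓ hW hW' hx (s := γ.1 - γ'.1) (by linarith) (by linarith)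
  rw [hy', D_shift W W' x hδ (J := Icc (γ.1 - γ'.1) γ.1)] at h2
  · have h4 : Icc 0 γ.1 = Ico 0 (γ.1 - γ'.1) ∪ Icc (γ.1 - γ'.1) γ.1 :=
      (Ico_union_Icc_eq_Icc (by linarith) (by linarith)).symm
    rw [h4, D_union hΓ hW hW' x (Metric.isBounded_Ico _ _) (Metric.isBounded_Icc _ _)] at h1
    · omega
    · rw [Set.disjoint_left]; intro t ht ht'; exact absurd ht.2 (not_lt.2 ht'.1)
  · intro t
    simp only [mem_Icc, Prod.fst_sub]
    constructor <;> rintro ⟨h, h'⟩ <;> constructor <;> linarith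

lemma image_disjoint {Γ : AddSubgroup (ℝ × (Fin d → ℝ))} (hΓ : IsLattice Γ)
    (hinj : Set.InjOn Prod.fst (Γ : Set (ℝ × (Fin d → ℝ))))
    {W W' : Set (Fin d → ℝ)} (hW : Bornology.IsBounded W) (hW' : Bornology.IsBounded W')
    {γ γ' : ℝ × (Fin d → ℝ)} (hγ : γ ∈ Γ) (hpos : 0 ≤ γ.1) (hγ' : γ' ∈ Γ) (hpos' : 0 ≤ γ'.1)
    {x y : Fin d → ℝ} (hx : x ∈ piece Γ W W' γ) (hy : y ∈ piece Γ W W' γ')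
    (he : x + γ.2 = y + γ'.2) : γ = γ' := by
  rcases lt_trichotomy γ.1 γ'.1 with h | h | h
  · exact (image_disjoint_aux hΓ hinj hW hW' hγ' hγ hpos h hy hx he.symm).elim
  · exact hinj hγ hγ' h
  · exact (image_disjoint_aux hΓ hinj hW hW' hγ hγ' hpos' h hx hy he).elim

lemma exists_time {Γ : AddSubgroup (ℝ × (Fin d → ℝ))} (hΓ : IsLattice Γ)
    (hinj : Set.InjOn Prod.fst (Γ : Set (ℝ × (Fin d → ℝ))))
    (hdense : Dense (Prod.snd '' (Γ : Set (ℝ × (Fin d → ℝ))))) {W W' : Set (Fin d → ℝ)}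
    (hW : RiemannMeasurable W) (hW' : RiemannMeasurable W')
    (hbde : BDEquiv (modelSet Γ W) (modelSet Γ W')) :
    ∃ T : ℝ, ∀ x ∈ W ∩ gen Γ W W', ∃ s, 0 < s ∧ s ≤ T ∧ D Γ W W' x (Ico 0 s) ≤ 0 := by
  obtain ⟨C, hC⟩ := bound_gen hΓ hinj hdense hW.1 hW'.1 hbde
  -- a generic point exists
  obtain ⟨z, hz⟩ : (gen Γ W W').Nonempty := by
    by_contra hne
    rw [not_nonempty_iff_eq_empty] at hne
    have := gen_compl_null hΓ hW.2 hW'.2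
    rw [hne, compl_empty] at this
    exact (isOpen_univ.measure_pos volume univ_nonempty).ne' this
  obtain ⟨M, ⟨x0, hx0, a0, b0, hab, hM⟩, hmax⟩ := Int.exists_greatest_of_bdd
    (P := fun m => ∃ x ∈ gen Γ W W', ∃ a b, a ≤ b ∧ D Γ W W' x (Ico a b) = m)
    ⟨C, by rintro m ⟨x, hx, a, b, hab, rfl⟩; exact hC x hx a b hab⟩
    ⟨_, z, hz, 0, 0, le_rfl, rfl⟩
  have hU : {y | D Γ W W' y (Ico a0 b0) = M} ∈ 𝓝 x0 := by
    filter_upwards [D_loc_const hΓ hW.1 hW'.1 hx0 a0 b0] with y hy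
    rw [hy _ Ico_subset_Icc_self, hM]
  have hcov : ∃ T : ℝ, ∀ x ∈ closure W, ∃ γ ∈ Γ, 0 < a0 + γ.1 ∧ a0 + γ.1 ≤ T ∧
      D Γ W W' (x + γ.2) (Ico a0 b0) = M := by
    refine hW.1.isCompact_closure.induction_on
      (p := fun S => ∃ T : ℝ, ∀ x ∈ S, ∃ γ ∈ Γ, 0 < a0 + γ.1 ∧ a0 + γ.1 ≤ T ∧
      D Γ W W' (x + γ.2) (Ico a0 b0) = M) ⟨0, by simp⟩ ?_ ?_ ?_
    · rintro S S' hS ⟨T, hT⟩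
      exact ⟨T, fun x hx => hT x (hS hx)⟩
    · rintro S S' ⟨T, hT⟩ ⟨T', hT'⟩
      refine ⟨max T T', ?_⟩
      rintro x (hx | hx)
      · obtain ⟨γ, h1, h2, h3, h4⟩ := hT x hx
        exact ⟨γ, h1, h2, h3.trans (le_max_left _ _), h4⟩
      · obtain ⟨γ, h1, h2, h3, h4⟩ := hT' x hx
        exact ⟨γ, h1, h2, h3.trans (le_max_right _ _), h4⟩
    · intro x _
      obtain ⟨γ, hγ, h1, h2⟩ := exists_visit hΓ hinj hdense (-a0) x hU
      have hc : Tendsto (fun y => y + γ.2) (𝓝 x) (𝓝 (x + γ.2)) :=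
        (continuous_id.add continuous_const).tendsto x
      refine ⟨_, mem_nhdsWithin_of_mem_nhds (hc h2), a0 + γ.1, ?_⟩
      intro y hy
      exact ⟨γ, hγ, by linarith, le_rfl, hy⟩
  obtain ⟨T, hT⟩ := hcov
  refine ⟨T, fun x hx => ?_⟩
  obtain ⟨γ, hγ, h1, h2, h3⟩ := hT x (subset_closure hx.1)
  refine ⟨a0 + γ.1, h1, h2, ?_⟩
  rw [D_shift W W' x hγ (J := Ico (a0 + γ.1) (b0 + γ.1)) (by intro t; simp)] at h3
  have h4 := hmax _ ⟨x, hx.2, 0, b0 + γ.1, by linarith, rfl⟩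
  rw [← Ico_union_Ico_eq_Ico (b := a0 + γ.1) h1.le (by linarith),
    D_union hΓ hW.1 hW'.1 x (Metric.isBounded_Ico _ _) (Metric.isBounded_Ico _ _)] at h4
  · omega
  · rw [Set.disjoint_left]; intro t ht ht'; exact absurd ht.2 (not_lt.2 ht'.1)

lemma core {Γ : AddSubgroup (ℝ × (Fin d → ℝ))} (hΓ : IsLattice Γ)
    (hinj : Set.InjOn Prod.fst (Γ : Set (ℝ × (Fin d → ℝ))))
    (hdense : Dense (Prod.snd '' (Γ : Set (ℝ × (Fin d → ℝ))))) {W W' : Set (Fin d → ℝ)}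
    (hW : RiemannMeasurable W) (hW' : RiemannMeasurable W')
    (hbde : BDEquiv (modelSet Γ W) (modelSet Γ W')) :
    ∃ (k : ℕ) (P : Fin k → Set (Fin d → ℝ)) (h : Fin k → (Fin d → ℝ)),
      (∀ j, RiemannMeasurable (P j)) ∧ (∀ j, h j ∈ Prod.snd '' (Γ : Set (ℝ × (Fin d → ℝ)))) ∧
      (∀ j, P j ⊆ W) ∧ (∀ j, h j +ᵥ P j ⊆ W') ∧ Pairwise (Function.onFun Disjoint P) ∧
      Pairwise (Function.onFun Disjoint (fun j => h j +ᵥ P j)) ∧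
      W ∩ gen Γ W W' ⊆ ⋃ j, P j := by
  obtain ⟨T, hT⟩ := exists_time hΓ hinj hdense hW hW' hbde
  obtain ⟨R, hR⟩ := hW.1.exists_norm_le
  obtain ⟨R', hR'⟩ := hW'.1.exists_norm_le
  have hfin := finite_box hΓ 0 T (R' + R)
  set G := hfin.toFinset with hG
  let g : Fin G.card → ℝ × (Fin d → ℝ) := fun j => (G.equivFin.symm j : ℝ × (Fin d → ℝ))
  have hg : ∀ j, g j ∈ Γ ∧ (g j).1 ∈ Icc 0 T ∧ ‖(g j).2‖ ≤ R' + R := fun j => by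
    have := (G.equivFin.symm j).2
    exact hfin.mem_toFinset.1 this
  have hginj : Function.Injective g := Subtype.val_injective.comp G.equivFin.symm.injective
  have hgsurj : ∀ γ, γ ∈ Γ → γ.1 ∈ Icc 0 T → ‖γ.2‖ ≤ R' + R → ∃ j, g j = γ := by
    intro γ h1 h2 h3
    refine ⟨G.equivFin ⟨γ, by rw [hG, Set.Finite.mem_toFinset]; exact ⟨h1, h2, h3⟩⟩, ?_⟩
    simp [g]
  refine ⟨G.card, fun j => piece Γ W W' (g j), fun j => (g j).2, fun j => piece_riemann hΓ hW hW' _,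
    fun j => ⟨g j, (hg j).1, rfl⟩, fun j x hx => hx.1, ?_, ?_, ?_, ?_⟩
  · rintro j _ ⟨x, hx, rfl⟩
    have := (piece_key hΓ hinj hW.1 hW'.1 (hg j).1 (hg j).2.1.1 hx).1
    rwa [add_comm] at this
  · intro i j hij
    rw [Function.onFun, Set.disjoint_left]
    intro x hx hx'
    exact hij (hginj (piece_disjoint hinj (hg i).1 (hg i).2.1.1 (hg j).1 (hg j).2.1.1 hx hx'))
  · intro i j hij
    rw [Function.onFun, Set.disjoint_left]
    rintro _ ⟨x, hx, rfl⟩ ⟨y, hy, he⟩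
    refine hij (hginj (image_disjoint hΓ hinj hW.1 hW'.1 (hg i).1 (hg i).2.1.1 (hg j).1
      (hg j).2.1.1 hx hy ?_))
    rw [add_comm x, add_comm y]; exact he.symm
  · intro x hx
    obtain ⟨s, hs0, hsT, hs⟩ := hT x hx
    have hEfin : {γ | γ ∈ cp Γ (W ∪ W') x (Icc 0 T) ∧ D Γ W W' x (Icc 0 γ.1) ≤ 0}.Finite :=
      (cp_finite hΓ (hW.1.union hW'.1) x (Metric.isBounded_Icc 0 T)).subset fun γ h => h.1
    obtain ⟨γ0, hγ0, he0⟩ := rounding (Γ := Γ) hΓ hW.1 hW'.1 hx.1 (J := Ico 0 s) (T := s)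
      ⟨le_rfl, hs0⟩ Ico_subset_Icc_self (fun t ht u hu => ⟨hu.1, hu.2.trans_lt ht.2⟩)
    obtain ⟨γ, ⟨hγ, hγD⟩, hmin⟩ := hEfin.exists_minimalFor Prod.fst _
      ⟨γ0, ⟨hγ0.1, ⟨hγ0.2.1.1, hγ0.2.1.2.le.trans hsT⟩, hγ0.2.2⟩, by rw [← he0]; exact hs⟩
    have hp : x ∈ piece Γ W W' γ := by
      refine ⟨hx.1, hγD, fun t ht0 ht => ?_⟩
      by_contra! hcon
      obtain ⟨η, hη, he⟩ := rounding (Γ := Γ) hΓ hW.1 hW'.1 hx.1 (J := Icc 0 t) (T := t)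
        ⟨le_rfl, ht0⟩ subset_rfl (fun t ht u hu => ⟨hu.1, hu.2.trans ht.2⟩)
      have hηγ : η.1 < γ.1 := hη.2.1.2.trans_lt ht
      have := hmin (j := η) ⟨⟨hη.1, ⟨hη.2.1.1, hηγ.le.trans hγ.2.1.2⟩, hη.2.2⟩, by rw [← he]; exact hcon⟩
        hηγ.le
      exact absurd this (not_le.2 hηγ)
    have hw' := (piece_key hΓ hinj hW.1 hW'.1 hγ.1 hγ.2.1.1 hp).1
    obtain ⟨j, hj⟩ := hgsurj γ hγ.1 hγ.2.1 (by
      calc ‖γ.2‖ = ‖(x + γ.2) - x‖ := by congr 1; abel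
        _ ≤ ‖x + γ.2‖ + ‖x‖ := norm_sub_le _ _
        _ ≤ _ := add_le_add (hR' _ hw') (hR _ hx.1))
    rw [mem_iUnion]
    exact ⟨j, by rw [hj]; exact hp⟩

lemma vol_le {W : Set (Fin d → ℝ)} {k : ℕ} {P : Fin k → Set (Fin d → ℝ)}
    {h : Fin k → (Fin d → ℝ)} {X : Set (Fin d → ℝ)} (hX : volume Xᶜ = 0)
    (hP : ∀ j, RiemannMeasurable (P j))
    (hd : Pairwise (Function.onFun Disjoint (fun j => h j +ᵥ P j)))
    (hc : W ∩ X ⊆ ⋃ j, P j) :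
    volume W ≤ volume (⋃ j, h j +ᵥ P j) := by
  have hm : ∀ j, NullMeasurableSet (h j +ᵥ P j) volume := fun j =>
    NullMeasurableSet.vadd (nullMeasurableSet_of_null_frontier (hP j).2) _
  calc volume W ≤ volume ((⋃ j, P j) ∪ Xᶜ) := measure_mono fun x hx => by
        by_cases h : x ∈ X
        · exact Or.inl (hc ⟨hx, h⟩)
        · exact Or.inr h
    _ ≤ volume (⋃ j, P j) + volume Xᶜ := measure_union_le _ _
    _ = volume (⋃ j, P j) := by rw [hX, add_zero]
    _ ≤ ∑' j, volume (P j) := measure_iUnion_le _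
    _ = ∑' j, volume (h j +ᵥ P j) := by simp only [measure_vadd]
    _ = volume (⋃ j, h j +ᵥ P j) := (measure_iUnion₀ (fun i j hij => (hd hij).aedisjoint) hm).symm

lemma bde_symm {Λ Λ' : Set ℝ} (h : BDEquiv Λ Λ') : BDEquiv Λ' Λ := by
  obtain ⟨K, hK, χ, hχ, hd⟩ := h
  refine ⟨K, hK, (Equiv.ofBijective χ hχ).symm, (Equiv.ofBijective χ hχ).symm.bijective, fun p => ?_⟩
  have h1 := hd ((Equiv.ofBijective χ hχ).symm p)
  have h2 : χ ((Equiv.ofBijective χ hχ).symm p) = p := (Equiv.ofBijective χ hχ).apply_symm_apply p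
  rw [h2, dist_comm] at h1
  exact h1

end BDEaux

/-- If `Γ` is a lattice in `ℝ × ℝ^d` with `p₁|_Γ` injective and `p₂(Γ)` dense, and
`W, W' ⊆ ℝ^d` are bounded Riemann measurable sets whose one-dimensional model sets
`Λ(Γ, W)` and `Λ(Γ, W')` are bounded distance equivalent, then `W, W'` are
equidecomposable up to measure zero with Riemann measurable pieces using
translations from `p₂(Γ)`. -/
theorem bde_onedim_modelSets_implies_equidecomposable_riemann {d : ℕ}
    (Γ : AddSubgroup (ℝ × (Fin d → ℝ))) (hΓ : IsLattice Γ)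
    (hinj : Set.InjOn Prod.fst (Γ : Set (ℝ × (Fin d → ℝ))))
    (hdense : Dense (Prod.snd '' (Γ : Set (ℝ × (Fin d → ℝ)))))
    (W W' : Set (Fin d → ℝ))
    (hW : RiemannMeasurable W) (hW' : RiemannMeasurable W')
    (hbde : BDEquiv (modelSet Γ W) (modelSet Γ W')) :
    EquidecompUpToNullRiemannPieces W W'
      (Prod.snd '' (Γ : Set (ℝ × (Fin d → ℝ)))) := by
  obtain ⟨k, P, h, hP, hH, hPW, hPW', hd, hd', hc⟩ :=
    BDEaux.core hΓ hinj hdense hW hW' hbde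
  obtain ⟨k₂, P₂, h₂, hP₂, -, -, hPW₂, -, hd₂, hc₂⟩ :=
    BDEaux.core hΓ hinj hdense hW' hW (BDEaux.bde_symm hbde)
  have hg := BDEaux.gen_compl_null hΓ hW.2 hW'.2
  have h1 : volume W ≤ volume (⋃ j, h j +ᵥ P j) := BDEaux.vol_le hg hP hd' hc
  have h2 : volume W' ≤ volume W :=
    (BDEaux.vol_le (BDEaux.gen_compl_null hΓ hW'.2 hW.2) hP₂ hd₂ hc₂).trans
      (measure_mono (Set.iUnion_subset hPW₂))
  have hm : NullMeasurableSet (⋃ j, h j +ᵥ P j) volume := NullMeasurableSet.iUnion fun j =>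
    NullMeasurableSet.vadd (nullMeasurableSet_of_null_frontier (hP j).2) _
  have hfin : volume W' ≠ ⊤ := hW'.1.measure_lt_top.ne
  have hae := ae_eq_of_subset_of_measure_ge (Set.iUnion_subset hPW') (h2.trans h1) hm hfin
  have hnull : volume (W' \ ⋃ j, h j +ᵥ P j) = 0 := (ae_eq_set.1 hae).2
  refine ⟨k, P, h, BDEaux.gen Γ W W' ∩ (W' \ ⋃ j, h j +ᵥ P j)ᶜ, ?_, hP, hH, ⟨?_, ?_⟩, ⟨?_, ?_⟩⟩
  · rw [Set.compl_inter, compl_compl]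
    exact measure_union_null hg hnull
  · rw [← Set.iUnion_inter]
    ext x
    constructor
    · rintro ⟨hx, hx'⟩
      obtain ⟨j, hj⟩ := Set.mem_iUnion.1 hx
      exact ⟨hPW j hj, hx'⟩
    · rintro ⟨hx, hx'⟩
      exact ⟨hc ⟨hx, hx'.1⟩, hx'⟩
  · intro i j hij
    exact (hd hij).mono Set.inter_subset_left Set.inter_subset_left
  · rw [← Set.iUnion_inter]
    ext x
    constructor
    · rintro ⟨hx, hx'⟩
      exact ⟨Set.iUnion_subset hPW' hx, hx'⟩
    · rintro ⟨hx, hx'⟩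
      refine ⟨?_, hx'⟩
      by_contra hn
      exact hx'.2 ⟨hx, hn⟩
  · intro i j hij
    exact (hd' hij).mono Set.inter_subset_left Set.inter_subset_left
end
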